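/- Assume case (BS2) and fix k ≥ 1. For i = (i_0, …, i_k) ∈ [0, c)^{k+1} let α(i) = b^{i_0} a b^{i_1} a ⋯ b^{i_k} a ∈ Λ. Then: (i) there exist a unique j = ψ(i) ∈ [0, c)^{k+1} and a unique integer r = r(i) such that b^{d·r} α(j) = α(i) b^c; moreover r ≥ 1 and j_0 = i_0. (ii) If 0 ≤ q < c, then b^{i_0 + 1} is not an initial segment of α(i) b^q, i.e., α(i) b^q ∉ b^{i_0+1} Λ. -/

import Mathlib

inductive BSGen : Type
  | a : BSGen
  | b : BSGen

/-- The relations for the Baumslag–Solitar presentation `⟨a, b | a bᶜ = bᵉ a⟩`.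
For cases (BS1), (BS2) take `e = d`; for case (BS3) take `e = -d`. -/
def BSRel (c e : ℤ) : Set (FreeGroup BSGen) :=
  {FreeGroup.of BSGen.a * FreeGroup.of BSGen.b ^ c *
    (FreeGroup.of BSGen.b ^ e * FreeGroup.of BSGen.a)⁻¹}

/-- The Baumslag–Solitar group `Γ = ⟨a, b | a bᶜ = bᵉ a⟩`. -/
abbrev BSGroup (c e : ℤ) := PresentedGroup (BSRel c e)

/-- The generator `a` of `Γ`. -/
def bsa (c e : ℤ) : BSGroup c e := PresentedGroup.of BSGen.a

/-- The generator `b` of `Γ`. -/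
def bsb (c e : ℤ) : BSGroup c e := PresentedGroup.of BSGen.b

/-- `Λ`, the submonoid of `Γ` generated by `a` and `b`. -/
def bsΛ (c e : ℤ) : Submonoid (BSGroup c e) :=
  Submonoid.closure {bsa c e, bsb c e}

/-- For a tuple `i : Fin n → ℤ`, the element `α(i) = b^{i₀} a b^{i₁} a ⋯ b^{i_{n-1}} a`. -/
def alphaTup (c e : ℤ) {n : ℕ} (i : Fin n → ℤ) : BSGroup c e :=
  (List.ofFn (fun μ : Fin n => bsb c e ^ i μ * bsa c e)).prod

/-- The isomorphism `c • x ↦ d • x` between the subgroups `cℤ` and `dℤ` of `ℤ`. -/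
noncomputable def zmultiplesEquiv (c d : ℤ) (hc : c ≠ 0) (hd : d ≠ 0) :
    (zpowersHom (Multiplicative ℤ) (Multiplicative.ofAdd c)).range ≃*
      (zpowersHom (Multiplicative ℤ) (Multiplicative.ofAdd d)).range :=
  have inj : ∀ e : ℤ, e ≠ 0 →
      Function.Injective (zpowersHom (Multiplicative ℤ) (Multiplicative.ofAdd e)) := by
    intro e he x y h
    have h' := congrArg Multiplicative.toAdd h
    simp only [zpowersHom_apply, toAdd_zpow, toAdd_ofAdd, smul_eq_mul] at h'
    exact Multiplicative.toAdd.injective (mul_right_cancel₀ he h')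
  (MonoidHom.ofInjective (inj c hc)).symm.trans (MonoidHom.ofInjective (inj d hd))

theorem coe_zmultiplesEquiv_ofAdd (c d : ℤ) (hc : c ≠ 0) (hd : d ≠ 0)
    (h : Multiplicative.ofAdd c ∈
      (zpowersHom (Multiplicative ℤ) (Multiplicative.ofAdd c)).range) :
    (zmultiplesEquiv c d hc hd ⟨Multiplicative.ofAdd c, h⟩ : Multiplicative ℤ) =
      Multiplicative.ofAdd d := by
  have key : zmultiplesEquiv c d hc hd ((zpowersHom (Multiplicative ℤ)
      (Multiplicative.ofAdd c)).rangeRestrict (Multiplicative.ofAdd 1)) =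
      (zpowersHom (Multiplicative ℤ) (Multiplicative.ofAdd d)).rangeRestrict
        (Multiplicative.ofAdd 1) := by
    unfold zmultiplesEquiv
    rw [MulEquiv.trans_apply]
    erw [MulEquiv.symm_apply_apply (MonoidHom.ofInjective _)]
    rfl
  have e : (⟨Multiplicative.ofAdd c, h⟩ :
      (zpowersHom (Multiplicative ℤ) (Multiplicative.ofAdd c)).range) =
      (zpowersHom (Multiplicative ℤ) (Multiplicative.ofAdd c)).rangeRestrict
        (Multiplicative.ofAdd 1) := by
    ext; simp
  rw [e, key]
  simp

theorem isComplement_range_zpowersHom (e : ℤ) (he : 0 < e) :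
    Subgroup.IsComplement
      ((zpowersHom (Multiplicative ℤ) (Multiplicative.ofAdd e)).range : Set (Multiplicative ℤ))
      {x | 0 ≤ x.toAdd ∧ x.toAdd < e} := by
  rw [Subgroup.isComplement_iff_existsUnique_mul_inv_mem]
  have mem : ∀ x : Multiplicative ℤ,
      x ∈ ((zpowersHom (Multiplicative ℤ) (Multiplicative.ofAdd e)).range :
        Set (Multiplicative ℤ)) ↔ e ∣ x.toAdd := by
    intro x
    constructor
    · rintro ⟨y, rfl⟩
      simp
    · rintro ⟨y, hy⟩
      refine ⟨Multiplicative.ofAdd y, Multiplicative.toAdd.injective ?_⟩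
      simp [hy, mul_comm]
  intro g
  refine ⟨⟨Multiplicative.ofAdd (g.toAdd % e), Int.emod_nonneg _ he.ne',
    Int.emod_lt_of_pos _ he⟩, ?_, ?_⟩
  · refine (mem _).2 ?_
    simpa [← sub_eq_add_neg] using Int.dvd_self_sub_emod
  · rintro ⟨y, hy0, hy1⟩ hy
    have hy' : e ∣ g.toAdd - y.toAdd := by simpa [sub_eq_add_neg] using (mem _).1 hy
    refine Subtype.ext (Multiplicative.toAdd.injective ?_)
    have h2 := Int.emod_eq_emod_iff_emod_sub_eq_zero.2 (Int.emod_eq_zero_of_dvd hy')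
    rw [Int.emod_eq_of_lt hy0 hy1] at h2
    exact h2.symm

/-- The transversals `[0, c)` of `cℤ` and `[0, d)` of `dℤ` in `ℤ`. -/
def intTransversalPair (c d : ℤ) (hc : 0 < c) (hd : 0 < d) :
    HNNExtension.NormalWord.TransversalPair (Multiplicative ℤ)
      (zpowersHom (Multiplicative ℤ) (Multiplicative.ofAdd c)).range
      (zpowersHom (Multiplicative ℤ) (Multiplicative.ofAdd d)).range where
  set u := {x | 0 ≤ x.toAdd ∧ x.toAdd < if u = 1 then c else d}
  compl u := by
    rcases Int.units_eq_one_or u with rfl | rfl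
    · simpa using isComplement_range_zpowersHom c hc
    · simpa using isComplement_range_zpowersHom d hd

theorem of_ofAdd_one_zpow {A B : Subgroup (Multiplicative ℤ)} (φ : A ≃* B) (n : ℤ) :
    (HNNExtension.of (Multiplicative.ofAdd 1) : HNNExtension (Multiplicative ℤ) A B φ) ^ n =
      HNNExtension.of (Multiplicative.ofAdd n) := by
  rw [← map_zpow, ← ofAdd_zsmul, smul_eq_mul, mul_one]

/-- The canonical map from the Baumslag–Solitar group to the corresponding HNN extension of `ℤ`. -/
noncomputable def bsToHNN (c d : ℤ) (hc : c ≠ 0) (hd : d ≠ 0) :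
    BSGroup c d →* HNNExtension (Multiplicative ℤ) _ _ (zmultiplesEquiv c d hc hd) :=
  PresentedGroup.toGroup
    (f := fun x => BSGen.rec HNNExtension.t (HNNExtension.of (Multiplicative.ofAdd 1)) x) (by
      rintro r rfl
      have hm : Multiplicative.ofAdd c ∈
          (zpowersHom (Multiplicative ℤ) (Multiplicative.ofAdd c)).range :=
        ⟨Multiplicative.ofAdd 1, by simp⟩
      have h := HNNExtension.t_mul_of (φ := zmultiplesEquiv c d hc hd) ⟨Multiplicative.ofAdd c, hm⟩
      rw [coe_zmultiplesEquiv_ofAdd] at h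
      simp only [map_mul, map_inv, map_zpow, FreeGroup.lift_apply_of]
      rw [mul_inv_eq_one, of_ofAdd_one_zpow, of_ofAdd_one_zpow]
      exact h)

theorem bsToHNN_bsa (c d : ℤ) (hc : c ≠ 0) (hd : d ≠ 0) :
    bsToHNN c d hc hd (bsa c d) = HNNExtension.t :=
  PresentedGroup.toGroup.of _

theorem bsToHNN_bsb_zpow (c d : ℤ) (hc : c ≠ 0) (hd : d ≠ 0) (n : ℤ) :
    bsToHNN c d hc hd (bsb c d ^ n) = HNNExtension.of (Multiplicative.ofAdd n) := by
  have h : bsToHNN c d hc hd (bsb c d) = HNNExtension.of (Multiplicative.ofAdd 1) :=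
    PresentedGroup.toGroup.of _
  rw [map_zpow, h, of_ofAdd_one_zpow]

/-- The element `b^n a b^{l₁} a b^{l₂} ⋯ a b^{l_p}` of the Baumslag–Solitar group. -/
def bsWord (c d n : ℤ) (L : List ℤ) : BSGroup c d :=
  bsb c d ^ n * (L.map fun l => bsa c d * bsb c d ^ l).prod

theorem bsWord_cons (c d n l : ℤ) (L : List ℤ) :
    bsWord c d n (l :: L) = bsb c d ^ n * (bsa c d * bsWord c d l L) := by
  simp [bsWord, mul_assoc]

theorem bsb_zpow_mul_bsWord (c d m n : ℤ) (L : List ℤ) :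
    bsb c d ^ m * bsWord c d n L = bsWord c d (m + n) L := by
  simp [bsWord, zpow_add, mul_assoc]

open HNNExtension in
theorem bsWord_injective (c d : ℤ) (hc : 0 < c) (hd : 0 < d) {n n' : ℤ} {L L' : List ℤ}
    (hL : ∀ l ∈ L, 0 ≤ l ∧ l < c) (hL' : ∀ l ∈ L', 0 ≤ l ∧ l < c)
    (h : bsWord c d n L = bsWord c d n' L') : n = n' ∧ L = L' := by
  let toNormal (n : ℤ) (L : List ℤ) (hL : ∀ l ∈ L, 0 ≤ l ∧ l < c) :
      NormalWord (intTransversalPair c d hc hd) :=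
    { head := Multiplicative.ofAdd n
      toList := L.map fun l => (1, Multiplicative.ofAdd l)
      chain := by
        rw [List.isChain_map]
        exact List.Pairwise.isChain (List.pairwise_of_forall fun _ _ _ => rfl)
      mem_set := by
        intro u g hg
        obtain ⟨l, hl, hlg⟩ := List.mem_map.1 hg
        obtain ⟨rfl, rfl⟩ := Prod.mk.inj hlg
        simpa [intTransversalPair] using hL l hl }
  have hprod : ∀ n L hL, (toNormal n L hL).prod (zmultiplesEquiv c d hc.ne' hd.ne') =
      bsToHNN c d hc.ne' hd.ne' (bsWord c d n L) := by
    intro n L hL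
    simp only [toNormal, NormalWord.ReducedWord.prod, bsWord, map_mul, bsToHNN_bsb_zpow,
      map_list_prod, List.map_map]
    congr 3
    funext l
    simp only [Function.comp_apply, map_mul, bsToHNN_bsb_zpow, bsToHNN_bsa, Units.val_one, zpow_one]
  have e : toNormal n L hL = toNormal n' L' hL' :=
    NormalWord.prod_injective (zmultiplesEquiv c d hc.ne' hd.ne') _ (by
      simp only [hprod, h])
  refine ⟨congrArg (fun w => w.head.toAdd) e, ?_⟩
  have e2 : L.map (fun l => ((1 : ℤˣ), Multiplicative.ofAdd l)) =
      L'.map fun l => ((1 : ℤˣ), Multiplicative.ofAdd l) := congrArg (fun w => w.toList) e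
  exact List.map_injective_iff.2 (fun x y hxy => Multiplicative.ofAdd.injective
    (Prod.mk.inj hxy).2) e2

theorem bsa_mul_bsb_zpow (c d : ℤ) : bsa c d * bsb c d ^ c = bsb c d ^ d * bsa c d := by
  have h : PresentedGroup.mk (BSRel c d) (FreeGroup.of BSGen.a * FreeGroup.of BSGen.b ^ c *
      (FreeGroup.of BSGen.b ^ d * FreeGroup.of BSGen.a)⁻¹) = 1 :=
    PresentedGroup.one_of_mem rfl
  rw [map_mul, map_inv, mul_inv_eq_one, map_mul, map_mul, map_zpow, map_zpow] at h
  exact h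

theorem bsa_mul_bsb_zpow_mul (c d m : ℤ) :
    bsa c d * bsb c d ^ (c * m) = bsb c d ^ (d * m) * bsa c d := by
  have h : SemiconjBy (bsa c d) (bsb c d ^ c) (bsb c d ^ d) := bsa_mul_bsb_zpow c d
  simpa only [zpow_mul] using (h.zpow_right m).eq

theorem bsa_mul_bsb_zpow_ediv (c d m : ℤ) :
    bsa c d * bsb c d ^ m = bsb c d ^ (d * (m / c)) * (bsa c d * bsb c d ^ (m % c)) := by
  rw [← mul_assoc, ← bsa_mul_bsb_zpow_mul, mul_assoc, ← zpow_add, Int.mul_ediv_add_emod]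

theorem bsa_mul_bsWord (c d n : ℤ) (L : List ℤ) :
    bsa c d * bsWord c d n L = bsWord c d (d * (n / c)) (n % c :: L) := by
  rw [bsWord_cons, bsWord, bsWord, ← mul_assoc, bsa_mul_bsb_zpow_ediv]
  simp only [mul_assoc]

theorem exists_bsWord_of_mem_bsΛ (c d : ℤ) (hc : 0 < c) (hd : 0 < d) {γ : BSGroup c d}
    (hγ : γ ∈ bsΛ c d) :
    ∃ n L, 0 ≤ n ∧ (∀ l ∈ L, 0 ≤ l ∧ l < c) ∧ γ = bsWord c d n L := by
  induction hγ using Submonoid.closure_induction_left with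
  | one => exact ⟨0, [], le_rfl, by simp, by simp [bsWord]⟩
  | mul_left x hx y _ ih =>
    obtain ⟨n, L, hn, hL, rfl⟩ := ih
    rcases hx with rfl | rfl
    · refine ⟨_, _, ?_, ?_, bsa_mul_bsWord c d n L⟩
      · exact mul_nonneg hd.le (Int.ediv_nonneg hn hc.le)
      · exact List.forall_mem_cons.2
          ⟨⟨Int.emod_nonneg _ hc.ne', Int.emod_lt_of_pos _ hc⟩, hL⟩
    · refine ⟨1 + n, L, by lia, hL, ?_⟩
      rw [← bsb_zpow_mul_bsWord, zpow_one]

theorem alphaTup_cons (c d : ℤ) {n : ℕ} (x : ℤ) (f : Fin n → ℤ) :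
    alphaTup c d (Fin.cons x f : Fin (n + 1) → ℤ) =
      bsb c d ^ x * (bsa c d * alphaTup c d f) := by
  simp [alphaTup, List.ofFn_succ, mul_assoc]

theorem alphaTup_cons_mul_bsb_zpow (c d : ℤ) {n : ℕ} (x q : ℤ) (f : Fin n → ℤ) :
    alphaTup c d (Fin.cons x f : Fin (n + 1) → ℤ) * bsb c d ^ q =
      bsWord c d x (List.ofFn f ++ [q]) := by
  induction n generalizing x with
  | zero => simp [alphaTup, bsWord, mul_assoc]
  | succ n ih =>
    obtain ⟨y, g, rfl⟩ : ∃ y g, f = Fin.cons y g := ⟨_, _, (Fin.cons_self_tail f).symm⟩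
    rw [alphaTup_cons, mul_assoc, mul_assoc, ih]
    simp [List.ofFn_succ, bsWord_cons]

theorem exists_alphaTup_cons_mul_bsb_zpow (c d : ℤ) (hc : 0 < c) (hcd : c < d) {n : ℕ} (x : ℤ)
    (f : Fin n → ℤ) (hf : ∀ μ, 0 ≤ f μ) :
    ∃ (r : ℤ) (g : Fin n → ℤ), 1 ≤ r ∧ (∀ μ, 0 ≤ g μ ∧ g μ < c) ∧
      bsb c d ^ (d * r) * alphaTup c d (Fin.cons x g : Fin (n + 1) → ℤ) =
        alphaTup c d (Fin.cons x f : Fin (n + 1) → ℤ) * bsb c d ^ c := by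
  induction n generalizing x with
  | zero =>
    refine ⟨1, f, le_rfl, Fin.rec0, ?_⟩
    simp only [alphaTup, List.ofFn_succ, List.ofFn_zero, Fin.cons_zero, List.prod_cons,
      List.prod_nil, mul_one]
    rw [mul_assoc, bsa_mul_bsb_zpow, ← mul_assoc, ← mul_assoc, ← zpow_add, ← zpow_add, add_comm]
  | succ n ih =>
    obtain ⟨y, f, rfl⟩ : ∃ y g, f = Fin.cons y g := ⟨_, _, (Fin.cons_self_tail f).symm⟩
    obtain ⟨r, g, hr, hg, h⟩ := ih y f fun μ => by simpa using hf μ.succ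
    have hy : 0 ≤ y := by simpa using hf 0
    refine ⟨(d * r + y) / c, Fin.cons ((d * r + y) % c) g, ?_, ?_, ?_⟩
    · rw [Int.le_ediv_iff_mul_le hc]
      nlinarith
    · refine Fin.cases ?_ ?_
      · simpa using ⟨Int.emod_nonneg _ hc.ne', Int.emod_lt_of_pos _ hc⟩
      · simpa using hg
    · rw [alphaTup_cons c d x (Fin.cons y f), mul_assoc, mul_assoc, ← h, alphaTup_cons,
        alphaTup_cons, alphaTup_cons, ← mul_assoc (bsb c d ^ (d * r)), ← zpow_add,
        ← mul_assoc (bsa c d) (bsb c d ^ (d * r + y)), bsa_mul_bsb_zpow_ediv]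
      simp only [← mul_assoc, ← zpow_add]
      rw [add_comm]

theorem bsb_zpow_mul_alphaTup_injective (c d : ℤ) (hc : 0 < c) (hcd : c < d) {n : ℕ} {r r' : ℤ}
    {f f' : Fin (n + 1) → ℤ} (hf : ∀ μ, 0 ≤ f μ ∧ f μ < c) (hf' : ∀ μ, 0 ≤ f' μ ∧ f' μ < c)
    (h : bsb c d ^ (d * r) * alphaTup c d f = bsb c d ^ (d * r') * alphaTup c d f') :
    f = f' ∧ r = r' := by
  obtain ⟨x, g, rfl⟩ : ∃ y g, f = Fin.cons y g := ⟨_, _, (Fin.cons_self_tail f).symm⟩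
  obtain ⟨x', g', rfl⟩ : ∃ y g, f' = Fin.cons y g := ⟨_, _, (Fin.cons_self_tail f').symm⟩
  have word : ∀ (x : ℤ) (g : Fin n → ℤ), alphaTup c d (Fin.cons x g : Fin (n + 1) → ℤ) =
      bsWord c d x (List.ofFn g ++ [0]) := fun x g => by
    rw [← alphaTup_cons_mul_bsb_zpow, zpow_zero, mul_one]
  rw [word, word, bsb_zpow_mul_bsWord, bsb_zpow_mul_bsWord] at h
  have bound : ∀ (x : ℤ) (g : Fin n → ℤ),
      (∀ μ, 0 ≤ (Fin.cons x g : Fin (n + 1) → ℤ) μ ∧ (Fin.cons x g : Fin (n + 1) → ℤ) μ < c) →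
      ∀ l ∈ List.ofFn g ++ [0], 0 ≤ l ∧ l < c := by
    intro x g hg l hl
    rcases List.mem_append.1 hl with hl | hl
    · obtain ⟨μ, rfl⟩ := (List.mem_ofFn' _ _).1 hl
      simpa using hg μ.succ
    · rw [List.mem_singleton.1 hl]
      exact ⟨le_rfl, hc⟩
  obtain ⟨h1, h2⟩ := bsWord_injective c d hc (hc.trans hcd) (bound x g hf) (bound x' g' hf') h
  have hg : g = g' := List.ofFn_injective (List.append_cancel_right h2)
  obtain ⟨hx0, hx1⟩ : 0 ≤ x ∧ x < c := by simpa using hf 0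
  obtain ⟨hx0', hx1'⟩ : 0 ≤ x' ∧ x' < c := by simpa using hf' 0
  have hr : r = r' := by
    rcases lt_trichotomy r r' with hlt | heq | hlt
    · nlinarith
    · exact heq
    · nlinarith
  subst hr hg
  exact ⟨by rw [add_left_cancel h1], rfl⟩

/-- Case (BS2), fixed `k ≥ 1`.  For `i ∈ [0,c)^{k+1}` let `α(i) = b^{i₀} a ⋯ b^{i_k} a`.
(i) There are a unique `j = ψ(i) ∈ [0,c)^{k+1}` and a unique `r = r(i) ∈ ℤ` with
`b^{dr} α(j) = α(i) b^c`; moreover `r ≥ 1` and `j₀ = i₀`.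
(ii) If `0 ≤ q < c` then `α(i) b^q ∉ b^{i₀+1} Λ`. -/
theorem statement5 (c d : ℤ) (hc : 1 ≤ c) (hcd : c < d) (k : ℕ) (hk : 1 ≤ k)
    (i : Fin (k + 1) → ℤ) (hi : ∀ μ, 0 ≤ i μ ∧ i μ < c) :
    (∃! w : (Fin (k + 1) → ℤ) × ℤ,
      (∀ μ, 0 ≤ w.1 μ ∧ w.1 μ < c) ∧
      bsb c d ^ (d * w.2) * alphaTup c d w.1 = alphaTup c d i * bsb c d ^ c) ∧
    (∀ w : (Fin (k + 1) → ℤ) × ℤ,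
      ((∀ μ, 0 ≤ w.1 μ ∧ w.1 μ < c) ∧
        bsb c d ^ (d * w.2) * alphaTup c d w.1 = alphaTup c d i * bsb c d ^ c) →
      1 ≤ w.2 ∧ w.1 0 = i 0) ∧
    (∀ q : ℤ, 0 ≤ q → q < c →
      ¬ ∃ γ ∈ bsΛ c d, alphaTup c d i * bsb c d ^ q = bsb c d ^ (i 0 + 1) * γ) := by
  have hc0 : 0 < c := hc
  have hd0 : 0 < d := hc0.trans hcd
  obtain ⟨x, f, rfl⟩ : ∃ y g, i = Fin.cons y g := ⟨_, _, (Fin.cons_self_tail i).symm⟩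
  have hx : 0 ≤ x ∧ x < c := by simpa using hi 0
  have hf : ∀ μ, 0 ≤ f μ ∧ f μ < c := fun μ => by simpa using hi μ.succ
  obtain ⟨r, g, hr, hg, h⟩ :=
    exists_alphaTup_cons_mul_bsb_zpow c d hc0 hcd x f fun μ => (hf μ).1
  have hg' : ∀ μ, 0 ≤ (Fin.cons x g : Fin (k + 1) → ℤ) μ ∧
      (Fin.cons x g : Fin (k + 1) → ℤ) μ < c :=
    Fin.cases (by simpa using hx) (by simpa using hg)
  refine ⟨⟨(Fin.cons x g, r), ⟨hg', h⟩, ?_⟩, ?_, ?_⟩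
  · rintro ⟨j, s⟩ ⟨hj, hs⟩
    obtain ⟨h1, h2⟩ := bsb_zpow_mul_alphaTup_injective c d hc0 hcd hj hg' (hs.trans h.symm)
    exact Prod.ext h1 h2
  · rintro ⟨j, s⟩ ⟨hj, hs⟩
    obtain ⟨rfl, rfl⟩ := bsb_zpow_mul_alphaTup_injective c d hc0 hcd hj hg' (hs.trans h.symm)
    exact ⟨hr, rfl⟩
  · rintro q hq0 hqc ⟨γ, hγ, e⟩
    obtain ⟨n, L, hn, hL, rfl⟩ := exists_bsWord_of_mem_bsΛ c d hc0 hd0 hγ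
    rw [alphaTup_cons_mul_bsb_zpow, bsb_zpow_mul_bsWord, Fin.cons_zero] at e
    have hl : ∀ l ∈ List.ofFn f ++ [q], 0 ≤ l ∧ l < c := by
      intro l hl
      rcases List.mem_append.1 hl with hl | hl
      · obtain ⟨μ, rfl⟩ := (List.mem_ofFn' _ _).1 hl
        exact hf μ
      · rw [List.mem_singleton.1 hl]
        exact ⟨hq0, hqc⟩
    have := (bsWord_injective c d hc0 hd0 hl hL e).1
    lia
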